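/- For an odd square-free positive integer n and an integer k coprime to n, the Gauss sum G_k(n) = ((1-i)/2 + (-1/n)(1+i)/2) · Σ_{a mod n} (a/n) e(ak/n) equals (k/n)·√n. -/

import Mathlib

open Complex Finset

/-- The Gauss-type sum `G_k(n)` for odd `n`. -/
noncomputable def gaussG (k : ℤ) (n : ℕ) : ℂ :=
  ((1 - Complex.I) / 2 + (jacobiSym (-1) n : ℂ) * (1 + Complex.I) / 2) *
    ∑ a ∈ Finset.range n, (jacobiSym (a : ℤ) n : ℂ) *
      Complex.exp (2 * Real.pi * Complex.I * ((a : ℂ) * (k : ℂ) / (n : ℂ)))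

open Polynomial in
/-- The Euler operator `X * d/dX` on polynomials. -/
noncomputable def eulerOperator (R : Type*) [CommRing R] : R[X] →ₗ[R] R[X] :=
  LinearMap.mulLeft R X ∘ₗ derivative

open Polynomial in
lemma eulerOperator_apply {R : Type*} [CommRing R] (f : R[X]) :
    eulerOperator R f = X * derivative f := rfl

open Polynomial in
lemma eulerOperator_pow_X_pow {R : Type*} [CommRing R] (m a : ℕ) :
    (eulerOperator R ^ m) (X ^ a) = (a : R) ^ m • X ^ a := by
  induction m with
  | zero => simp
  | succ m ih =>
    have h : eulerOperator R (X ^ a) = (a : R) • X ^ a := by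
      rw [eulerOperator_apply, derivative_X_pow, smul_eq_C_mul]
      rcases a with _ | a
      · simp
      · simp only [Nat.add_sub_cancel]; ring
    rw [pow_succ, Module.End.mul_apply, h, map_smul, ih, smul_smul, pow_succ']

open Polynomial in
lemma eval_one_eulerOperator_pow {R : Type*} [CommRing R] (m : ℕ) (G : R[X]) :
    ((eulerOperator R ^ m) ((X - 1) ^ m * G)).eval 1 = (m.factorial : R) * G.eval 1 := by
  induction m generalizing G with
  | zero => simp
  | succ m ih =>
    have h : eulerOperator R ((X - 1) ^ (m + 1) * G) =
        (X - 1) ^ m * (X * (((m : R[X]) + 1) * G + (X - 1) * derivative G)) := by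
      rw [eulerOperator_apply]
      simp only [derivative_mul, derivative_pow, derivative_sub, derivative_X, derivative_one]
      simp
      ring
    rw [pow_succ, Module.End.mul_apply, h, ih]
    simp [Nat.factorial_succ]
    ring

open Polynomial in
/-- A multiple of `(X - 1) ^ (m + 1)` is killed by `m` applications of the Euler operator followed
by evaluation at `1`. -/
lemma eval_one_eulerOperator_pow_of_dvd {R : Type*} [CommRing R] {m : ℕ} {f : R[X]}
    (h : (X - 1) ^ (m + 1) ∣ f) : ((eulerOperator R ^ m) f).eval 1 = 0 := by
  obtain ⟨G, rfl⟩ := h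
  rw [pow_succ, mul_assoc, eval_one_eulerOperator_pow]
  simp

open Polynomial in
lemma eval_one_eulerOperator_pow_prod {R : Type*} [CommRing R] (m : ℕ) (f : ℕ → R[X])
    (hf : ∀ j ∈ range m, (f j).eval 1 = 0) :
    ((eulerOperator R ^ m) (∏ j ∈ range m, f j)).eval 1 =
      (m.factorial : R) * ∏ j ∈ range m, (derivative (f j)).eval 1 := by
  have h : ∀ j, ∃ g : R[X], j ∈ range m → f j = (X - 1) * g := by
    intro j
    by_cases hj : j ∈ range m
    · have : (X - C 1 : R[X]) ∣ f j := dvd_iff_isRoot.2 (hf j hj)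
      obtain ⟨g, hg⟩ := this
      exact ⟨g, fun _ => by simpa using hg⟩
    · exact ⟨0, fun h => absurd h hj⟩
  choose g hg using h
  rw [Finset.prod_congr rfl hg, Finset.prod_mul_distrib, Finset.prod_const, card_range,
    eval_one_eulerOperator_pow, eval_prod]
  congr 1
  refine Finset.prod_congr rfl fun j hj => ?_
  rw [hg j hj]
  simp

open Polynomial in
lemma cyclotomic_prime_zmod (p : ℕ) [Fact p.Prime] :
    cyclotomic p (ZMod p) = (X - 1) ^ (p - 1) := by
  have hp := (Fact.out : p.Prime)
  have h := cyclotomic_prime_mul_X_sub_one (ZMod p) p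
  have h2 : (X ^ p - 1 : (ZMod p)[X]) = (X - 1) ^ (p - 1) * (X - 1) := by
    rw [← pow_succ, Nat.sub_add_cancel hp.one_le, sub_pow_char, one_pow]
  rw [h2] at h
  exact mul_right_cancel₀ (by simpa using X_sub_C_ne_zero (1 : ZMod p)) h

lemma sum_jacobiSym_mul_pow_half {p m : ℕ} [Fact p.Prime] (hm : p = 2 * m + 1) (hm0 : 0 < m) :
    ∑ a ∈ range p, ((jacobiSym (a : ℤ) p : ℤ) : ZMod p) * (a : ZMod p) ^ m = -1 := by
  have hp := (Fact.out : p.Prime)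
  have h : ∀ a ∈ range p, ((jacobiSym (a : ℤ) p : ℤ) : ZMod p) * (a : ZMod p) ^ m =
      if a = 0 then 0 else 1 := by
    intro a ha
    rw [← jacobiSym.legendreSym.to_jacobiSym, legendreSym.eq_pow, Int.cast_natCast,
      show p / 2 = m by omega, ← pow_add, show m + m = p - 1 by omega]
    split_ifs with h0
    · rw [h0, Nat.cast_zero, zero_pow]; omega
    · apply ZMod.pow_card_sub_one_eq_one
      rw [Ne, ZMod.natCast_eq_zero_iff]
      exact fun hd => absurd (Nat.le_of_dvd (Nat.pos_of_ne_zero h0) hd) (by simpa using ha)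
  have h2 : range p = range (2 * m + 1) := by rw [hm]
  have h3 : ((2 * m + 1 : ℕ) : ZMod p) = 0 := by rw [← hm]; simp
  rw [Finset.sum_congr rfl h, h2, Finset.sum_range_succ']
  simp
  push_cast at h3
  linear_combination h3

open Polynomial in
/-- If the Gauss sum over a primitive `p`-th root of unity is `ε` times the half product, then
`ε` is determined modulo `p`. -/
lemma gauss_sum_sign_mod {p m : ℕ} [Fact p.Prime] (hm : p = 2 * m + 1) (hm0 : 0 < m) {ζ : ℂ}
    (hζ : IsPrimitiveRoot ζ p) (ε : ℤ)
    (h : ∑ a ∈ range p, (jacobiSym (a : ℤ) p : ℂ) * ζ ^ a =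
      ε * ∏ j ∈ range m, (ζ ^ (j + 1) - ζ ^ (p - (j + 1)))) :
    (ε : ZMod p) * (m.factorial * ∏ j ∈ range m, (2 * ((j : ZMod p) + 1))) = -1 := by
  have hp := (Fact.out : p.Prime)
  set f : ℤ[X] := ∑ a ∈ range p, C (jacobiSym (a : ℤ) p) * X ^ a -
    C ε * ∏ j ∈ range m, (X ^ (j + 1) - X ^ (p - (j + 1))) with hf
  have h0 : aeval ζ f = 0 := by
    rw [hf, map_sub, map_sum, map_mul, map_prod]
    simp only [map_mul, map_sub, map_pow, aeval_X, aeval_C]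
    simpa [sub_eq_zero] using h
  have hd : cyclotomic p ℤ ∣ f := by
    rw [cyclotomic_eq_minpoly hζ hp.pos]
    exact minpoly.isIntegrallyClosed_dvd (hζ.isIntegral hp.pos) h0
  have hd2 : (X - 1 : (ZMod p)[X]) ^ (m + 1) ∣ f.map (Int.castRingHom (ZMod p)) := by
    refine (pow_dvd_pow _ (show m + 1 ≤ p - 1 by omega)).trans ?_
    rw [← cyclotomic_prime_zmod, ← map_cyclotomic_int]
    exact Polynomial.map_dvd _ hd
  have h1 := eval_one_eulerOperator_pow_of_dvd hd2
  have h2 : f.map (Int.castRingHom (ZMod p)) =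
      ∑ a ∈ range p, ((jacobiSym (a : ℤ) p : ℤ) : ZMod p) • X ^ a -
      (ε : ZMod p) • ∏ j ∈ range m, (X ^ (j + 1) - X ^ (p - (j + 1))) := by
    rw [hf]
    simp [Polynomial.map_sum, Polynomial.map_prod, smul_eq_C_mul]
  rw [h2, map_sub, map_sum, map_smul, eval_sub, eval_finsetSum, eval_smul,
    eval_one_eulerOperator_pow_prod _ _ (by simp)] at h1
  simp only [map_smul, eulerOperator_pow_X_pow, eval_smul, eval_pow, eval_X, one_pow,
    smul_eq_mul, mul_one] at h1
  rw [sum_jacobiSym_mul_pow_half hm hm0, sub_eq_zero] at h1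
  rw [h1]
  congr 2
  refine Finset.prod_congr rfl fun j hj => ?_
  have : j + 1 ≤ p := by have := Finset.mem_range.1 hj; omega
  simp [derivative_X_pow, Nat.cast_sub this]
  ring

lemma factorial_half_sq {p m : ℕ} [Fact p.Prime] (hm : p = 2 * m + 1) :
    (m.factorial : ZMod p) ^ 2 = (-1) ^ (m + 1) := by
  have h := ZMod.wilsons_lemma p
  rw [show p - 1 = m + m by omega, ← Finset.prod_range_add_one_eq_factorial,
    Finset.prod_range_add, Finset.prod_range_add_one_eq_factorial, Nat.cast_mul,
    ← Finset.prod_range_reflect] at h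
  have h2 : ((∏ j ∈ range m, (m + (m - 1 - j) + 1) : ℕ) : ZMod p) =
      (-1) ^ m * (m.factorial : ZMod p) := by
    rw [← Finset.prod_range_add_one_eq_factorial, Nat.cast_prod, Nat.cast_prod]
    have : (-1 : ZMod p) ^ m = ∏ j ∈ range m, (-1) := by simp
    rw [this, ← Finset.prod_mul_distrib]
    refine Finset.prod_congr rfl fun j hj => ?_
    have hj := Finset.mem_range.1 hj
    have h3 : ((m + (m - 1 - j) + 1 + (j + 1) : ℕ) : ZMod p) = 0 := by
      rw [show m + (m - 1 - j) + 1 + (j + 1) = p by omega]; simp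
    push_cast at h3 ⊢
    linear_combination h3
  rw [h2] at h
  have h4 : ((-1 : ZMod p) ^ m) ^ 2 = 1 := by rw [← pow_mul, mul_comm, pow_mul]; simp
  rw [pow_succ]
  linear_combination (-1) ^ m * h - (m.factorial : ZMod p) ^ 2 * h4

lemma sign_eq_of_mod {p m : ℕ} [Fact p.Prime] (hm : p = 2 * m + 1) (hm0 : 0 < m) {ε : ℤ}
    (hε : ε = 1 ∨ ε = -1)
    (h : (ε : ZMod p) * (m.factorial * ∏ j ∈ range m, (2 * ((j : ZMod p) + 1))) = -1) :
    ε = (-1) ^ m * ZMod.χ₈ p := by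
  have h2 : (2 : ZMod p) ^ m = ((ZMod.χ₈ p : ℤ) : ZMod p) := by
    rw [← legendreSym.at_two (p := p) (by omega), legendreSym.eq_pow, show p / 2 = m by omega]
    norm_num
  have hfac : ∏ j ∈ range m, ((j : ZMod p) + 1) = m.factorial := by
    rw [← Finset.prod_range_add_one_eq_factorial]; push_cast; rfl
  rw [Finset.prod_mul_distrib, Finset.prod_const, card_range, h2, hfac] at h
  have hf := factorial_half_sq hm
  have hχ : ZMod.χ₈ p = 1 ∨ ZMod.χ₈ p = -1 := by
    rw [ZMod.χ₈_nat_eq_if_mod_eight, if_neg (by omega)]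
    split_ifs <;> simp
  have key : (ε : ZMod p) * ((-1) ^ m * ((ZMod.χ₈ p : ℤ) : ZMod p)) = 1 := by
    rw [pow_succ] at hf
    linear_combination (-1 : ZMod p) * h + (ε : ZMod p) * ((ZMod.χ₈ p : ℤ) : ZMod p) * hf
  have hne : (-1 : ZMod p) ≠ 1 := by
    have : Fact (2 < p) := ⟨by omega⟩
    exact ZMod.neg_one_ne_one
  rcases hε with rfl | rfl <;> rcases hχ with hχ | hχ <;> rw [hχ] at key ⊢ <;>
    rcases neg_one_pow_eq_or ℤ m with hs | hs <;>
    · have hs' : (-1 : ZMod p) ^ m = (((-1) ^ m : ℤ) : ZMod p) := by push_cast; rfl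
      rw [hs', hs] at key
      rw [hs]
      simp at key ⊢
      try exact hne key

lemma half_product_sq {m : ℕ} {ζ : ℂ} (hζ : IsPrimitiveRoot ζ (2 * m + 1)) :
    (∏ j ∈ range m, (ζ ^ (j + 1) - ζ ^ (2 * m + 1 - (j + 1)))) ^ 2 =
      (-1) ^ m * ((2 * m + 1 : ℕ) : ℂ) := by
  have hprod : ∏ k ∈ range (m + m), (1 - (ζ ^ 2) ^ (k + 1)) = ((2 * m : ℕ) : ℂ) + 1 := by
    rw [← two_mul]
    exact (hζ.pow_of_coprime 2 (by simp)).prod_one_sub_pow_eq_order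
  have hone := hζ.pow_eq_one
  rw [Finset.prod_range_add,
    ← Finset.prod_range_reflect (fun x => 1 - (ζ ^ 2) ^ (m + x + 1)),
    ← Finset.prod_mul_distrib] at hprod
  have hneg : (-1 : ℂ) ^ m = ∏ j ∈ range m, (-1) := by simp
  rw [Nat.cast_succ, ← hprod, hneg, ← Finset.prod_pow, ← Finset.prod_mul_distrib]
  refine Finset.prod_congr rfl fun j hj => ?_
  have hj := Finset.mem_range.1 hj
  have hxy : ζ ^ (j + 1) * ζ ^ (2 * m + 1 - (j + 1)) = 1 := by
    rw [← pow_add, show j + 1 + (2 * m + 1 - (j + 1)) = 2 * m + 1 by omega, hone]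
  rw [show m + (m - 1 - j) + 1 = 2 * m + 1 - (j + 1) by omega,
    pow_right_comm ζ 2, pow_right_comm ζ 2]
  generalize ζ ^ (2 * m + 1 - (j + 1)) = y at hxy ⊢
  linear_combination (ζ ^ (j + 1) * y - 1) * hxy

lemma half_product_eq (m : ℕ) {ζ : ℂ}
    (hζ : ζ = exp (2 * Real.pi * I / ((2 * m + 1 : ℕ) : ℂ))) :
    ∏ j ∈ range m, (ζ ^ (j + 1) - ζ ^ (2 * m + 1 - (j + 1))) =
      I ^ m * (Real.sqrt ((2 * m + 1 : ℕ) : ℝ) : ℂ) := by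
  have hprim : IsPrimitiveRoot ζ (2 * m + 1) := hζ ▸ Complex.isPrimitiveRoot_exp _ (by omega)
  set R : ℝ := ∏ j ∈ range m, (2 * Real.sin (2 * Real.pi * (j + 1) / ((2 * m + 1 : ℕ) : ℝ)))
    with hR
  have hpos : 0 < R := by
    refine Finset.prod_pos fun j hj => mul_pos two_pos (Real.sin_pos_of_pos_of_lt_pi ?_ ?_)
    · have := Real.pi_pos
      positivity
    · have hj : (j : ℝ) + 1 ≤ m := by exact_mod_cast Finset.mem_range.1 hj
      rw [div_lt_iff₀ (by positivity)]
      push_cast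
      nlinarith [Real.pi_pos]
  have hprod : ∏ j ∈ range m, (ζ ^ (j + 1) - ζ ^ (2 * m + 1 - (j + 1))) = I ^ m * (R : ℂ) := by
    have hI : I ^ m = ∏ j ∈ range m, I := by simp
    rw [hR, hI, ofReal_prod, ← Finset.prod_mul_distrib]
    refine Finset.prod_congr rfl fun j hj => ?_
    have hj := Finset.mem_range.1 hj
    have hinv : ζ ^ (2 * m + 1 - (j + 1)) = (ζ ^ (j + 1))⁻¹ := by
      refine eq_inv_of_mul_eq_one_left ?_
      rw [← pow_add, Nat.sub_add_cancel (by omega), hprim.pow_eq_one]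
    have hexp : ζ ^ (j + 1) =
        exp ((2 * Real.pi * (j + 1) / ((2 * m + 1 : ℕ) : ℂ)) * I) := by
      rw [hζ, ← Complex.exp_nat_mul]
      congr 1
      push_cast
      ring
    rw [hinv, hexp, ← Complex.exp_neg, ← neg_mul, Complex.exp_mul_I, Complex.exp_mul_I,
      Complex.cos_neg, Complex.sin_neg]
    push_cast
    ring
  have hsq := half_product_sq hprim
  rw [hprod, mul_pow, ← pow_mul, mul_comm m 2, pow_mul, I_sq] at hsq
  have hsq' : R ^ 2 = ((2 * m + 1 : ℕ) : ℝ) := by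
    have := mul_left_cancel₀ (pow_ne_zero m (by norm_num : (-1 : ℂ) ≠ 0)) hsq
    exact_mod_cast this
  rw [hprod, ← hsq', Real.sqrt_sq hpos.le]

/-- The quadratic character modulo a prime, with complex values. -/
noncomputable def complexQuadraticChar (p : ℕ) [Fact p.Prime] : MulChar (ZMod p) ℂ :=
  (quadraticChar (ZMod p)).ringHomComp (Int.castRingHom ℂ)

lemma complexQuadraticChar_intCast (p : ℕ) [Fact p.Prime] (a : ℤ) :
    complexQuadraticChar p (a : ZMod p) = (jacobiSym a p : ℂ) := by
  rw [← jacobiSym.legendreSym.to_jacobiSym]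
  rfl

lemma sum_range_eq_sum_zmod (n : ℕ) [NeZero n] (f : ZMod n → ℂ) :
    ∑ a ∈ range n, f (a : ZMod n) = ∑ x : ZMod n, f x := by
  refine Finset.sum_nbij' (fun a => (a : ZMod n)) (fun x => x.val) (by simp)
    (fun x _ => Finset.mem_range.2 x.val_lt) (fun a ha => ZMod.val_cast_of_lt (by simpa using ha))
    (fun x _ => ZMod.natCast_zmod_val x) (fun _ _ => rfl)

lemma sum_jacobiSym_eq_gaussSum (p : ℕ) [Fact p.Prime] (k : ℤ) :
    ∑ a ∈ range p, (jacobiSym (a : ℤ) p : ℂ) *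
      exp (2 * Real.pi * I * ((a : ℂ) * (k : ℂ) / (p : ℂ))) =
    gaussSum (complexQuadraticChar p) (ZMod.stdAddChar.mulShift (k : ZMod p)) := by
  rw [gaussSum, ← sum_range_eq_sum_zmod]
  refine Finset.sum_congr rfl fun a _ => ?_
  have h : (k : ZMod p) * (a : ZMod p) = ((a * k : ℤ) : ZMod p) := by push_cast; ring
  have h2 := complexQuadraticChar_intCast p a
  rw [Int.cast_natCast] at h2
  rw [h2, AddChar.mulShift_apply, h, ZMod.stdAddChar_coe]
  congr 2
  push_cast
  ring

lemma complexQuadraticChar_isQuadratic (p : ℕ) [Fact p.Prime] :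
    (complexQuadraticChar p).IsQuadratic :=
  (quadraticChar_isQuadratic (ZMod p)).comp _

lemma complexQuadraticChar_ne_one {p : ℕ} [Fact p.Prime] (hp : p ≠ 2) :
    complexQuadraticChar p ≠ 1 := by
  obtain ⟨a, ha⟩ := quadraticChar_exists_neg_one' (F := ZMod p) (by rwa [ZMod.ringChar_zmod_n])
  intro h
  have h1 : complexQuadraticChar p (a : ZMod p) = 1 := by rw [h, MulChar.one_apply_coe]
  rw [complexQuadraticChar, MulChar.ringHomComp_apply, ha] at h1
  norm_num at h1

lemma gaussSum_complexQuadraticChar_eq {p m : ℕ} [Fact p.Prime] (hm : p = 2 * m + 1)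
    (hm0 : 0 < m) :
    gaussSum (complexQuadraticChar p) ZMod.stdAddChar =
      (((-1) ^ m * ZMod.χ₈ p : ℤ) : ℂ) * (I ^ m * (Real.sqrt p : ℂ)) := by
  have hsq := gaussSum_sq (complexQuadraticChar_ne_one (p := p) (by omega))
    (complexQuadraticChar_isQuadratic p) (ZMod.isPrimitive_stdAddChar p)
  have hneg : complexQuadraticChar p (-1) = (-1) ^ m := by
    have h := complexQuadraticChar_intCast p (-1)
    push_cast at h
    rw [h, jacobiSym.at_neg_one ⟨m, hm⟩, ZMod.χ₄_eq_neg_one_pow (by omega),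
      show p / 2 = m by omega]
    push_cast
    rfl
  rw [hneg, ZMod.card] at hsq
  set ζ : ℂ := exp (2 * Real.pi * I / ((2 * m + 1 : ℕ) : ℂ)) with hζ
  have hprim : IsPrimitiveRoot ζ (2 * m + 1) := Complex.isPrimitiveRoot_exp _ (by omega)
  have hP := half_product_eq m hζ
  have hPsq := half_product_sq hprim
  rw [← hm] at hP hPsq hprim
  have hsum : gaussSum (complexQuadraticChar p) ZMod.stdAddChar =
      ∑ a ∈ range p, (jacobiSym (a : ℤ) p : ℂ) * ζ ^ a := by
    have h := sum_jacobiSym_eq_gaussSum p 1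
    have h1 : ((1 : ℤ) : ZMod p) = 1 := Int.cast_one
    rw [h1, AddChar.mulShift_one] at h
    rw [← h]
    refine Finset.sum_congr rfl fun a _ => ?_
    rw [hζ, ← Complex.exp_nat_mul, ← hm]
    congr 2
    push_cast
    ring
  obtain ⟨ε, hε, h⟩ : ∃ ε : ℤ, (ε = 1 ∨ ε = -1) ∧
      gaussSum (complexQuadraticChar p) ZMod.stdAddChar =
        ε * ∏ j ∈ range m, (ζ ^ (j + 1) - ζ ^ (p - (j + 1))) := by
    rcases sq_eq_sq_iff_eq_or_eq_neg.1 (hsq.trans hPsq.symm) with h | h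
    · exact ⟨1, Or.inl rfl, by simpa using h⟩
    · exact ⟨-1, Or.inr rfl, by simpa using h⟩
  have hsign := sign_eq_of_mod hm hm0 hε (gauss_sum_sign_mod hm hm0 hprim ε (hsum ▸ h))
  rw [h, hP, hsign]

/-- The normalizing factor is `1` if `n ≡ 1 mod 4` and `-i` if `n ≡ 3 mod 4`. -/
lemma gauss_factor_eq {n : ℕ} (hn : Odd n) :
    (1 - I) / 2 + (jacobiSym (-1) n : ℂ) * (1 + I) / 2 = if n % 4 = 1 then 1 else -I := by
  rw [jacobiSym.at_neg_one hn]
  have : n % 4 = 1 ∨ n % 4 = 3 := Nat.odd_mod_four_iff.1 (Nat.odd_iff.1 hn)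
  rcases this with h | h
  · rw [ZMod.χ₄_nat_one_mod_four h, if_pos h]; push_cast; ring
  · rw [ZMod.χ₄_nat_three_mod_four h, if_neg (by omega)]; push_cast; ring

lemma gauss_factor_mul_sign {p m : ℕ} (hm : p = 2 * m + 1) :
    (if p % 4 = 1 then 1 else -I) * ((((-1) ^ m * ZMod.χ₈ p : ℤ) : ℂ) * I ^ m) = 1 := by
  have hp : ¬ p % 2 = 0 := by omega
  rw [ZMod.χ₈_nat_eq_if_mod_eight, if_neg hp]
  obtain ⟨q, r, hr, rfl⟩ : ∃ q r, r < 4 ∧ m = 4 * q + r :=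
    ⟨m / 4, m % 4, Nat.mod_lt _ (by norm_num), (Nat.div_add_mod m 4).symm⟩
  have h1 : (-1 : ℂ) ^ (4 * q) = 1 := by rw [pow_mul]; norm_num
  have h2 : I ^ (4 * q) = 1 := by rw [pow_mul, I_pow_four, one_pow]
  interval_cases r
  · rw [if_pos (by omega), if_pos (by omega)]; simp [h1, h2]
  · rw [if_neg (by omega), if_neg (by omega)]; simp [pow_succ, h1, h2]
  · rw [if_pos (by omega), if_neg (by omega)]; simp [pow_succ, h1, h2]
  · rw [if_neg (by omega), if_pos (by omega)]; simp [pow_succ, h1, h2]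

lemma gaussG_prime {p : ℕ} (hp : p.Prime) (hodd : Odd p) (k : ℤ) (hk : IsCoprime k (p : ℤ)) :
    gaussG k p = (jacobiSym k p : ℂ) * (Real.sqrt p : ℂ) := by
  have : Fact p.Prime := ⟨hp⟩
  obtain ⟨m, hm⟩ := hodd
  have hm0 : 0 < m := by have := hp.two_le; omega
  have hu : IsUnit (k : ZMod p) := (ZMod.coe_int_isUnit_iff_isCoprime k p).2 hk.symm
  have hshift := gaussSum_mulShift (complexQuadraticChar p) ZMod.stdAddChar hu.unit
  rw [IsUnit.unit_spec, complexQuadraticChar_intCast,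
    gaussSum_complexQuadraticChar_eq hm hm0] at hshift
  have hJ : (jacobiSym k p : ℂ) * (jacobiSym k p : ℂ) = 1 := by
    rw [← sq]
    exact_mod_cast jacobiSym.sq_one (Int.isCoprime_iff_gcd_eq_one.1 hk)
  rw [gaussG, sum_jacobiSym_eq_gaussSum, gauss_factor_eq ⟨m, hm⟩]
  have h := gauss_factor_mul_sign hm
  set S := gaussSum (complexQuadraticChar p) (ZMod.stdAddChar.mulShift (k : ZMod p))
  set c : ℂ := if p % 4 = 1 then 1 else -I
  linear_combination (-c * S) * hJ + c * (jacobiSym k p : ℂ) * hshift +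
    (jacobiSym k p : ℂ) * (Real.sqrt p : ℂ) * h

/-- Multiplicativity of the unnormalized sums. -/
lemma sum_jacobiSym_mul {m n : ℕ} (hm : 0 < m) (hn : 0 < n) (hmn : m.Coprime n) (k : ℤ) :
    ∑ a ∈ range (m * n), (jacobiSym (a : ℤ) (m * n) : ℂ) *
      exp (2 * Real.pi * I * ((a : ℂ) * (k : ℂ) / ((m * n : ℕ) : ℂ))) =
    ((jacobiSym n m : ℂ) * (jacobiSym m n : ℂ)) *
      ((∑ a ∈ range m, (jacobiSym (a : ℤ) m : ℂ) *
        exp (2 * Real.pi * I * ((a : ℂ) * (k : ℂ) / (m : ℂ)))) *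
      ∑ a ∈ range n, (jacobiSym (a : ℤ) n : ℂ) *
        exp (2 * Real.pi * I * ((a : ℂ) * (k : ℂ) / (n : ℂ)))) := by
  have : NeZero m := ⟨hm.ne'⟩
  have : NeZero n := ⟨hn.ne'⟩
  have hmaps : Set.MapsTo (fun x : ℕ × ℕ => (x.1 * n + x.2 * m) % (m * n))
      (range m ×ˢ range n : Finset (ℕ × ℕ)) (range (m * n)) := fun x _ =>
    Finset.mem_coe.2 (Finset.mem_range.2 (Nat.mod_lt _ (Nat.mul_pos hm hn)))
  have hinj : Set.InjOn (fun x : ℕ × ℕ => (x.1 * n + x.2 * m) % (m * n))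
      (range m ×ˢ range n : Finset (ℕ × ℕ)) := by
    rintro ⟨a, b⟩ hab ⟨c, d⟩ hcd h
    simp only [Finset.coe_product, Set.mem_prod, Finset.mem_coe, Finset.mem_range] at hab hcd
    have h : a * n + b * m ≡ c * n + d * m [MOD m * n] := h
    have h1 : a * n ≡ c * n [MOD m] := by
      simpa [Nat.ModEq, Nat.add_mul_mod_self_right] using h.of_mul_right n
    have h2 : b * m ≡ d * m [MOD n] := by
      simpa [Nat.ModEq, Nat.mul_add_mod_self_right] using h.of_mul_left m
    have h1 : a ≡ c [MOD m] := Nat.ModEq.cancel_right_of_coprime hmn h1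
    have h2 : b ≡ d [MOD n] := Nat.ModEq.cancel_right_of_coprime hmn.symm h2
    exact Prod.ext (h1.eq_of_lt_of_lt hab.1 hcd.1) (h2.eq_of_lt_of_lt hab.2 hcd.2)
  rw [Finset.sum_mul_sum, ← Finset.sum_product', Finset.mul_sum]
  symm
  refine Finset.sum_nbij _ hmaps hinj
    (Finset.surjOn_of_injOn_of_card_le _ hmaps hinj (by simp)) ?_
  rintro ⟨a, b⟩ -
  have hJm : jacobiSym (((a * n + b * m) % (m * n) : ℕ) : ℤ) m =
      jacobiSym a m * jacobiSym n m := by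
    rw [← jacobiSym.mul_left]
    refine jacobiSym.mod_left' ?_
    push_cast
    rw [Int.emod_emod_of_dvd _ (dvd_mul_right _ _), Int.add_mul_emod_self_right]
  have hJn : jacobiSym (((a * n + b * m) % (m * n) : ℕ) : ℤ) n =
      jacobiSym b n * jacobiSym m n := by
    rw [← jacobiSym.mul_left]
    refine jacobiSym.mod_left' ?_
    push_cast
    rw [Int.emod_emod_of_dvd _ (dvd_mul_left _ _), add_comm, Int.add_mul_emod_self_right]
  have hexp : exp (2 * Real.pi * I *
      ((((a * n + b * m) % (m * n) : ℕ) : ℂ) * (k : ℂ) / ((m * n : ℕ) : ℂ))) =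
      exp (2 * Real.pi * I * ((a : ℂ) * (k : ℂ) / (m : ℂ))) *
        exp (2 * Real.pi * I * ((b : ℂ) * (k : ℂ) / (n : ℂ))) := by
    have hdiv := congrArg (Nat.cast : ℕ → ℂ) (Nat.mod_add_div (a * n + b * m) (m * n))
    set r := (a * n + b * m) % (m * n)
    set q := (a * n + b * m) / (m * n)
    have hm' : (m : ℂ) ≠ 0 := by exact_mod_cast hm.ne'
    have hn' : (n : ℂ) ≠ 0 := by exact_mod_cast hn.ne'
    rw [← Complex.exp_add, Complex.exp_eq_exp_iff_exists_int]
    refine ⟨-(q * k), ?_⟩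
    push_cast at hdiv ⊢
    field_simp
    linear_combination (k : ℂ) * hdiv
  simp only
  rw [jacobiSym.mul_right, hJm, hJn, hexp]
  push_cast
  ring

lemma gauss_factor_mul {m n : ℕ} (hm : Odd m) (hn : Odd n) (hmn : m.Coprime n) :
    (if (m * n) % 4 = 1 then (1 : ℂ) else -I) * ((jacobiSym n m : ℂ) * (jacobiSym m n : ℂ)) =
      (if m % 4 = 1 then (1 : ℂ) else -I) * (if n % 4 = 1 then (1 : ℂ) else -I) := by
  have hJ : (jacobiSym m n : ℂ) * (jacobiSym m n : ℂ) = 1 := by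
    rw [← sq]
    exact_mod_cast jacobiSym.sq_one (a := m) (b := n) (by simpa using hmn)
  have hm4 : m % 4 = 1 ∨ m % 4 = 3 := Nat.odd_mod_four_iff.1 (Nat.odd_iff.1 hm)
  have hn4 : n % 4 = 1 ∨ n % 4 = 3 := Nat.odd_mod_four_iff.1 (Nat.odd_iff.1 hn)
  have hmul := Nat.mul_mod m n 4
  rcases hm4 with h1 | h1
  · rw [← jacobiSym.quadratic_reciprocity_one_mod_four h1 hn, hJ]
    rcases hn4 with h2 | h2 <;> simp [hmul, h1, h2]
  · rcases hn4 with h2 | h2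
    · rw [jacobiSym.quadratic_reciprocity_one_mod_four h2 hm, hJ]
      simp [hmul, h1, h2]
    · rw [jacobiSym.quadratic_reciprocity_three_mod_four h2 h1]
      push_cast
      rw [neg_mul, hJ]
      simp [hmul, h1, h2]

lemma gaussG_mul {m n : ℕ} (hm : Odd m) (hn : Odd n) (hmn : m.Coprime n) (k : ℤ) :
    gaussG k (m * n) = gaussG k m * gaussG k n := by
  rw [gaussG, gaussG, gaussG, gauss_factor_eq hm, gauss_factor_eq hn,
    gauss_factor_eq (hm.mul hn), sum_jacobiSym_mul hm.pos hn.pos hmn, ← mul_assoc,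
    gauss_factor_mul hm hn hmn]
  ring

lemma gaussG_one (k : ℤ) : gaussG k 1 = 1 := by
  rw [gaussG, gauss_factor_eq odd_one]
  simp

theorem gaussG_squarefree (n : ℕ) (hn : 0 < n) (hodd : Odd n) (hsf : Squarefree n)
    (k : ℤ) (hk : IsCoprime k (n : ℤ)) :
    gaussG k n = (jacobiSym k n : ℂ) * (Real.sqrt n : ℂ) := by
  induction n using Nat.recOnPosPrimePosCoprime with
  | prime_pow p r hp hr =>
    obtain ⟨-, rfl⟩ := (Nat.squarefree_pow_iff hp.ne_one hr.ne').1 hsf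
    rw [pow_one] at *
    exact gaussG_prime hp hodd k hk
  | zero => exact absurd hn (lt_irrefl 0)
  | one => simp [gaussG_one]
  | coprime a b ha hb hab iha ihb =>
    obtain ⟨hoa, hob⟩ := Nat.odd_mul.1 hodd
    obtain ⟨hsa, hsb⟩ := (Nat.squarefree_mul hab).1 hsf
    rw [Nat.cast_mul] at hk
    have : NeZero a := ⟨by omega⟩
    have : NeZero b := ⟨by omega⟩
    rw [gaussG_mul hoa hob hab, iha hoa.pos hoa hsa hk.of_mul_right_left,
      ihb hob.pos hob hsb hk.of_mul_right_right, jacobiSym.mul_right, Nat.cast_mul,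
      Real.sqrt_mul (Nat.cast_nonneg a)]
    push_cast
    ring
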